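/- arXiv:2507.18779 — 6 statements merged into one kernel-verified Lean document; each statement's English description precedes it below -/
import Mathlib

section
/- Suppose d ≥ 3 and β ≥ 12, or d = 2 and β > 12 (β real). Then the set C of words of L expressible as concatenations of 4-powers has exponential growth rate strictly smaller than the topological entropy: limsup_{n→∞} (1/n) log #(C ∩ A^n) < h. -/
open MeasureTheory Filter Real Set

/-- The left shift on bi-infinite sequences. -/
def shift {A : Type*} (x : ℤ → A) : ℤ → A := fun n => x (n + 1)

/-- `w` occurs as a factor (finite subword) of the bi-infinite sequence `x`. -/
def FactorOf {A : Type*} (w : List A) (x : ℤ → A) : Prop :=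
  ∃ i : ℤ, ∀ t : ℕ, (ht : t < w.length) → x (i + t) = w[t]

/-- `ℓ` is a period of the word `w`. -/
def HasPeriodN {A : Type*} (w : List A) (ℓ : ℕ) : Prop :=
  1 ≤ ℓ ∧ ℓ ≤ w.length ∧ ∀ t : ℕ, (ht : t + ℓ < w.length) →
    w[t]'(lt_of_le_of_lt (Nat.le_add_right t ℓ) ht) = w[t + ℓ]

/-- The `d`-ary `β`-free shift. -/
def betaFree (d : ℕ) (β : ℝ) : Set (ℤ → Fin d) :=
  {x | ∀ w : List (Fin d), FactorOf w x → ∀ ℓ : ℕ, HasPeriodN w ℓ → (w.length : ℝ) < β * ℓ}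

/-- The language of a shift space. -/
def language {A : Type*} (X : Set (ℤ → A)) : Set (List A) :=
  {w | ∃ x ∈ X, FactorOf w x}

/-- The words of length `n` in the language of `X`. -/
def langN {A : Type*} (X : Set (ℤ → A)) (n : ℕ) : Set (List A) :=
  {w | w ∈ language X ∧ w.length = n}

/-- The cylinder of a word. -/
def cylinder {A : Type*} (w : List A) : Set (ℤ → A) :=
  {x | ∀ t : ℕ, (ht : t < w.length) → x (t : ℤ) = w[t]}

/-- A shift space: closed and shift-invariant. -/
def IsShiftSpace {A : Type*} [TopologicalSpace A] (X : Set (ℤ → A)) : Prop :=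
  IsClosed X ∧ shift '' X = X

/-- Invariance of a measure under the shift. -/
def IsShiftInvariant {A : Type*} [MeasurableSpace A] (μ : Measure (ℤ → A)) : Prop :=
  ∀ E : Set (ℤ → A), MeasurableSet E → μ (shift ⁻¹' E) = μ E

/-- The `n`-th partition sum `H_n(μ) = Σ_w −μ[w] log μ[w]`. -/
noncomputable def cylEntropySum {A : Type*} [Fintype A] [MeasurableSpace A]
    (μ : Measure (ℤ → A)) (n : ℕ) : ℝ :=
  ∑ w : Fin n → A, Real.negMulLog (μ (cylinder (List.ofFn w))).toReal

/-- `μ` is a measure of maximal entropy on `X` (with topological entropy `h`). -/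
def IsMME {A : Type*} [Fintype A] [MeasurableSpace A]
    (X : Set (ℤ → A)) (h : ℝ) (μ : Measure (ℤ → A)) : Prop :=
  IsProbabilityMeasure μ ∧ μ X = 1 ∧ IsShiftInvariant μ ∧
    Tendsto (fun n : ℕ => cylEntropySum μ n / n) atTop (nhds h)

/-- A word is a 4-power. -/
def IsFourPower {A : Type*} (s : List A) : Prop :=
  ∃ v : List A, v ≠ [] ∧ s = v ++ v ++ v ++ v

/-- Good words: words of the language no prefix or suffix of which is a 4-power. -/
def goodWords {A : Type*} (X : Set (ℤ → A)) : Set (List A) :=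
  {w | w ∈ language X ∧ (∀ p : List A, p <+: w → ¬ IsFourPower p) ∧
       (∀ s : List A, s <:+ w → ¬ IsFourPower s)}

/-- Words of the language that are concatenations of 4-powers of words of the language. -/
def fourPowerConcat {A : Type*} (X : Set (ℤ → A)) : Set (List A) :=
  {w | w ∈ language X ∧ ∃ ps : List (List A),
      (∀ p ∈ ps, ∃ v ∈ language X, v ≠ [] ∧ p = v ++ v ++ v ++ v) ∧ w = ps.flatten}

/-- Alternating concatenation `w₁u₁w₂u₂⋯`. -/
def alternate {A : Type*} : List (List A) → List (List A) → List A
  | [], _ => []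
  | w :: _, [] => w
  | w :: ws, u :: us => w ++ u ++ alternate ws us

/-- The map deleting the first `i` and the last `k` symbols of a word. -/
def phi {A : Type*} (i k : ℕ) (w : List A) : List A := (w.drop i).take (w.length - i - k)

/-- Maximal `k` such that the first `k` symbols of `w` follow the periodic
pattern of period `ℓ` determined by the prefix of `w` of length `ℓ`. -/
noncomputable def preK {A : Type*} (w : List A) (ℓ : ℕ) : ℕ :=
  sSup {k | k ≤ w.length ∧ ∀ t < k, w[t]? = w[t % ℓ]?}

/-- `pre_ℓ(w)`: the number of times the length-`ℓ` prefix of `w` repeats at the start of `w`. -/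
noncomputable def pre {A : Type*} (w : List A) (ℓ : ℕ) : ℝ := (preK w ℓ : ℝ) / ℓ

/-- `suf_ℓ(w)`: the number of times the length-`ℓ` suffix of `w` repeats at the end of `w`. -/
noncomputable def suf {A : Type*} (w : List A) (ℓ : ℕ) : ℝ := pre w.reverse ℓ

/-- No factor of `w` of length `12 * ℓ` has period `ℓ`. -/
def TwelveFree {A : Type*} (w : List A) : Prop :=
  ∀ i ℓ : ℕ, 1 ≤ ℓ → i + 12 * ℓ ≤ w.length → ∃ t < 11 * ℓ, w[i + t]? ≠ w[i + t + ℓ]?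

/-- The twelfth-power-free words of length `n`. -/
def twelveFreeN (d n : ℕ) : Set (List (Fin d)) :=
  {w | TwelveFree w ∧ w.length = n}

lemma ncard_length_eq (d n : ℕ) : {w : List (Fin d) | w.length = n}.ncard = d ^ n := by
  have h : Nat.card (List.Vector (Fin d) n) = d ^ n := by simp
  exact h

lemma twelveFreeN_finite (d n : ℕ) : (twelveFreeN d n).Finite :=
  (List.finite_length_eq (Fin d) n).subset fun _ hw => hw.2

lemma TwelveFree.drop {A : Type*} {w : List A} (hw : TwelveFree w) (k : ℕ) :
    TwelveFree (w.drop k) := by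
  intro i ℓ hℓ hi
  rw [List.length_drop] at hi
  obtain ⟨t, ht, hne⟩ := hw (k + i) ℓ hℓ (by omega)
  refine ⟨t, ht, ?_⟩
  simpa only [List.getElem?_drop, add_assoc] using hne

lemma TwelveFree.take {A : Type*} {w : List A} (hw : TwelveFree w) (k : ℕ) :
    TwelveFree (w.take k) := by
  intro i ℓ hℓ hi
  rw [List.length_take] at hi
  obtain ⟨t, ht, hne⟩ := hw i ℓ hℓ (by omega)
  refine ⟨t, ht, ?_⟩
  rwa [List.getElem?_take_of_lt (by omega), List.getElem?_take_of_lt (by omega)]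

/-- A word starting with a twelfth power of period `ℓ` is determined by what remains after
deleting its first `11 * ℓ` letters. -/
lemma eq_of_drop_eq {A : Type*} {z z' : List A} {ℓ : ℕ}
    (hz : ∀ t < 11 * ℓ, z[t]? = z[t + ℓ]?) (hz' : ∀ t < 11 * ℓ, z'[t]? = z'[t + ℓ]?)
    (h : z.drop (11 * ℓ) = z'.drop (11 * ℓ)) : z = z' := by
  apply List.ext_getElem?
  have key : ∀ j i : ℕ, 11 * ℓ ≤ i + j → z[i]? = z'[i]? := by
    intro j
    induction j with
    | zero =>
      intro i hi
      have := congrArg (fun l : List A => l[i - 11 * ℓ]?) h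
      simpa [List.getElem?_drop, Nat.add_sub_cancel' (show 11 * ℓ ≤ i by omega)] using this
    | succ j ih =>
      intro i hi
      by_cases hi' : i < 11 * ℓ
      · rw [hz i hi', hz' i hi']
        exact ih _ (by omega)
      · exact ih _ (by omega)
  exact fun i => key (11 * ℓ) i (by omega)

lemma TwelveFree.cons_or {A : Type*} {w : List A} (hw : TwelveFree w) (a : A) :
    TwelveFree (a :: w) ∨ ∃ ℓ, 1 ≤ ℓ ∧ 12 * ℓ ≤ w.length + 1 ∧
      ∀ t < 11 * ℓ, (a :: w)[t]? = (a :: w)[t + ℓ]? := by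
  by_contra! hc
  obtain ⟨h1, h2⟩ := hc
  apply h1
  intro i ℓ hℓ hi
  rw [List.length_cons] at hi
  cases i with
  | zero => simpa using h2 ℓ hℓ (by omega)
  | succ i =>
    obtain ⟨t, ht, hne⟩ := hw i ℓ hℓ (by omega)
    refine ⟨t, ht, ?_⟩
    rw [show i + 1 + t = i + t + 1 by omega, show i + t + 1 + ℓ = i + t + ℓ + 1 by omega]
    simpa using hne

lemma mul_ncard_twelveFreeN_le (d n : ℕ) :
    d * (twelveFreeN d n).ncard ≤ (twelveFreeN d (n + 1)).ncard +
      ∑ ℓ ∈ Finset.Icc 1 n with 11 * ℓ ≤ n + 1, (twelveFreeN d (n + 1 - 11 * ℓ)).ncard := by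
  set E : Set (List (Fin d)) :=
    (fun p : Fin d × List (Fin d) => p.1 :: p.2) '' (univ ×ˢ twelveFreeN d n) with hE
  set B : ℕ → Set (List (Fin d)) := fun ℓ =>
    {z | z ∈ E ∧ ∀ t < 11 * ℓ, z[t]? = z[t + ℓ]?} with hB
  have hEfin : E.Finite := (finite_univ.prod (twelveFreeN_finite d n)).image _
  have hEcard : E.ncard = d * (twelveFreeN d n).ncard := by
    rw [hE, ncard_image_of_injective, ncard_prod]
    · simp
    · rintro ⟨a, w⟩ ⟨b, v⟩ h
      simpa using h
  set I := (Finset.Icc 1 n).filter fun ℓ => 11 * ℓ ≤ n + 1 with hI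
  have hcover : E ⊆ twelveFreeN d (n + 1) ∪ ⋃ ℓ ∈ I, B ℓ := by
    rintro z hz
    have hz0 := hz
    obtain ⟨⟨a, w⟩, ⟨-, hw, hlen⟩, rfl⟩ := hz
    dsimp only at hw hlen
    rcases hw.cons_or a with h | ⟨ℓ, h1, h2, h3⟩
    · left
      exact ⟨h, by simpa using hlen⟩
    · right
      simp only [mem_iUnion]
      refine ⟨ℓ, ?_, hz0, h3⟩
      simp only [hI, Finset.mem_filter, Finset.mem_Icc]
      omega
  have hBcard : ∀ ℓ ∈ I, (B ℓ).ncard ≤ (twelveFreeN d (n + 1 - 11 * ℓ)).ncard := by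
    intro ℓ hℓ
    simp only [hI, Finset.mem_filter, Finset.mem_Icc] at hℓ
    apply ncard_le_ncard_of_injOn (fun z => z.drop (11 * ℓ)) _ _ (twelveFreeN_finite d _)
    · rintro z ⟨⟨⟨a, w⟩, ⟨-, hw, hlen⟩, rfl⟩, -⟩
      simp only at hlen
      obtain ⟨k, hk⟩ : ∃ k, 11 * ℓ = k + 1 := ⟨11 * ℓ - 1, by omega⟩
      refine ⟨?_, by simp [hlen]⟩
      simp only [hk, List.drop_succ_cons]
      exact hw.drop k
    · rintro z ⟨-, hz⟩ z' ⟨-, hz'⟩ h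
      exact eq_of_drop_eq hz hz' h
  have hfin : (twelveFreeN d (n + 1) ∪ ⋃ ℓ ∈ I, B ℓ).Finite :=
    (twelveFreeN_finite d _).union
      (I.finite_toSet.biUnion fun ℓ _ => hEfin.subset fun _ hz => hz.1)
  calc d * (twelveFreeN d n).ncard = E.ncard := hEcard.symm
    _ ≤ _ := ncard_le_ncard hcover hfin
    _ ≤ _ := ncard_union_le _ _
    _ ≤ _ := by
      gcongr
      exact (Finset.set_ncard_biUnion_le I B).trans (Finset.sum_le_sum hBcard)

lemma sum_Icc_pow_le {r : ℝ} (h0 : 0 ≤ r) (h1 : r < 1) (n : ℕ) :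
    ∑ ℓ ∈ Finset.Icc 1 n, r ^ ℓ ≤ r / (1 - r) := by
  have hpos : 0 < 1 - r := by linarith
  have key : ∀ m : ℕ, ∑ ℓ ∈ Finset.Icc 1 m, r ^ ℓ = (r - r ^ (m + 1)) / (1 - r) := by
    intro m
    induction m with
    | zero => simp
    | succ m ih =>
      rw [Finset.sum_Icc_succ_top (by omega), ih]
      field_simp
      ring
  rw [key]
  gcongr
  linarith [pow_nonneg h0 (n + 1)]

lemma twelveFreeN_growth {d : ℕ} (hd : 2 ≤ d) (n : ℕ) :
    (3 / 4 * d : ℝ) * (twelveFreeN d n).ncard ≤ (twelveFreeN d (n + 1)).ncard := by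
  have hd' : (2 : ℝ) ≤ d := by exact_mod_cast hd
  set γ : ℝ := 3 / 4 * d with hγ
  have hγ1 : 3 / 2 ≤ γ := by linarith
  induction n using Nat.strong_induction_on with
  | _ n ih =>
    have hback : ∀ j ≤ n, γ ^ j * (twelveFreeN d (n - j)).ncard ≤ (twelveFreeN d n).ncard := by
      intro j
      induction j with
      | zero => simp
      | succ j ihj =>
        intro hj
        refine le_trans ?_ (ihj (by omega))
        have := ih (n - (j + 1)) (by omega)
        rw [show n - (j + 1) + 1 = n - j by omega] at this
        rw [pow_succ, mul_assoc]
        gcongr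
    have hterm : ∀ ℓ ∈ (Finset.Icc 1 n).filter (fun ℓ => 11 * ℓ ≤ n + 1),
        ((twelveFreeN d (n + 1 - 11 * ℓ)).ncard : ℝ) ≤
          (1 / 3) ^ ℓ * (twelveFreeN d n).ncard := by
      intro ℓ hℓ
      simp only [Finset.mem_filter, Finset.mem_Icc] at hℓ
      have h1 := hback (11 * ℓ - 1) (by omega)
      rw [show n - (11 * ℓ - 1) = n + 1 - 11 * ℓ by omega] at h1
      have h2 : (3 : ℝ) ^ ℓ ≤ γ ^ (11 * ℓ - 1) :=
        calc (3 : ℝ) ^ ℓ ≤ ((3 / 2) ^ 10) ^ ℓ := by gcongr; norm_num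
          _ = (3 / 2) ^ (10 * ℓ) := by rw [pow_mul]
          _ ≤ (3 / 2) ^ (11 * ℓ - 1) := pow_le_pow_right₀ (by norm_num) (by omega)
          _ ≤ _ := by gcongr
      have h3 : (3 : ℝ) ^ ℓ * (twelveFreeN d (n + 1 - 11 * ℓ)).ncard ≤ (twelveFreeN d n).ncard :=
        le_trans (by gcongr) h1
      rw [div_pow, one_pow, div_mul_eq_mul_div, one_mul, le_div_iff₀ (by positivity)]
      linarith
    have hsum : ∑ ℓ ∈ Finset.Icc 1 n with 11 * ℓ ≤ n + 1,
        ((twelveFreeN d (n + 1 - 11 * ℓ)).ncard : ℝ) ≤ 1 / 2 * (twelveFreeN d n).ncard :=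
      calc _ ≤ ∑ ℓ ∈ Finset.Icc 1 n with 11 * ℓ ≤ n + 1,
              ((1 / 3 : ℝ) ^ ℓ * (twelveFreeN d n).ncard) := Finset.sum_le_sum hterm
        _ ≤ ∑ ℓ ∈ Finset.Icc 1 n, ((1 / 3 : ℝ) ^ ℓ * (twelveFreeN d n).ncard) :=
            Finset.sum_le_sum_of_subset_of_nonneg (Finset.filter_subset _ _)
              fun _ _ _ => by positivity
        _ ≤ _ := by
            rw [← Finset.sum_mul]
            gcongr
            exact (sum_Icc_pow_le (by norm_num) (by norm_num) n).trans (by norm_num)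
    have hrec : (d : ℝ) * (twelveFreeN d n).ncard ≤ (twelveFreeN d (n + 1)).ncard +
        ∑ ℓ ∈ Finset.Icc 1 n with 11 * ℓ ≤ n + 1,
          ((twelveFreeN d (n + 1 - 11 * ℓ)).ncard : ℝ) := by
      exact_mod_cast mul_ncard_twelveFreeN_le d n
    have hnn : (0 : ℝ) ≤ (twelveFreeN d n).ncard := by positivity
    rw [hγ]
    nlinarith

lemma pow_le_ncard_twelveFreeN {d : ℕ} (hd : 2 ≤ d) (n : ℕ) :
    (3 / 4 * d : ℝ) ^ n ≤ (twelveFreeN d n).ncard := by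
  induction n with
  | zero =>
    have : twelveFreeN d 0 = {[]} := by
      ext w
      simp only [twelveFreeN, mem_ofPred_eq, List.length_eq_zero_iff, mem_singleton_iff,
        and_iff_right_iff_imp]
      rintro rfl i ℓ hℓ hi
      simp only [List.length_nil] at hi
      omega
    simp [this]
  | succ n ih =>
    refine le_trans ?_ (twelveFreeN_growth hd n)
    rw [pow_succ']
    gcongr

/-- The sequences carrying `w` at the origin and having no twelfth power in the window
`[-m, w.length + m)`. -/
def windowFree {d : ℕ} (w : List (Fin d)) (m : ℕ) : Set (ℤ → Fin d) :=
  {x | (∀ t : ℕ, (ht : t < w.length) → x t = w[t]) ∧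
    ∀ (i : ℤ) (ℓ : ℕ), 1 ≤ ℓ → -m ≤ i → i + 12 * ℓ ≤ w.length + m →
      ∃ t < 11 * ℓ, x (i + t) ≠ x (i + t + ℓ)}

lemma isClosed_windowFree {d : ℕ} (w : List (Fin d)) (m : ℕ) : IsClosed (windowFree w m) := by
  simp only [windowFree, ofPred_and, ofPred_forall]
  refine (isClosed_iInter fun t => isClosed_iInter fun _ =>
    isClosed_eq (continuous_apply _) continuous_const).inter
    (isClosed_iInter fun i => isClosed_iInter fun ℓ => isClosed_iInter fun _ =>
      isClosed_iInter fun _ => isClosed_iInter fun _ => ?_)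
  have : {x : ℤ → Fin d | ∃ t < 11 * ℓ, x (i + t) ≠ x (i + t + ℓ)} =
      ⋃ t ∈ Finset.range (11 * ℓ), {x : ℤ → Fin d | x (i + t) ≠ x (i + t + ℓ)} := by
    ext x
    simp
  rw [this]
  refine isClosed_biUnion_finset fun t _ => ?_
  have hc : Continuous fun x : ℤ → Fin d => (x (i + t), x (i + t + ℓ)) := by fun_prop
  exact (isClosed_discrete {p : Fin d × Fin d | p.1 ≠ p.2}).preimage hc

lemma mem_language_of_windowFree {d : ℕ} {β : ℝ} (hβ : 12 ≤ β) {w : List (Fin d)}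
    (hne : ∀ m, (windowFree w m).Nonempty) : w ∈ language (betaFree d β) := by
  have hanti : Antitone (windowFree w) := by
    intro m m' hm x hx
    exact ⟨hx.1, fun i ℓ hℓ h1 h2 => hx.2 i ℓ hℓ (by omega) (by omega)⟩
  obtain ⟨x, hx⟩ := IsCompact.nonempty_iInter_of_directed_nonempty_isCompact_isClosed
    (windowFree w) hanti.directed_ge hne (fun m => (isClosed_windowFree w m).isCompact)
    (isClosed_windowFree w)
  rw [mem_iInter] at hx
  refine ⟨x, ?_, 0, by simpa using (hx 0).1⟩
  rintro u ⟨i, hu⟩ ℓ ⟨hℓ, -, hper⟩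
  by_contra! hlen
  have hlen' : 12 * ℓ ≤ u.length := by
    have h : (12 : ℝ) * ℓ ≤ u.length := le_trans (by gcongr) hlen
    exact_mod_cast h
  obtain ⟨t, ht, hxt⟩ := (hx (i.natAbs + 12 * ℓ)).2 i ℓ hℓ (by omega) (by omega)
  apply hxt
  have h2 := hu (t + ℓ) (by omega)
  rw [hu t (by omega), add_assoc, ← Nat.cast_add, h2]
  exact hper t (by omega)

lemma windowFree_nonempty {d m : ℕ} {p w s : List (Fin d)} (hd : 0 < d) (hp : p.length = m)
    (hs : s.length = m) (hfree : TwelveFree (p ++ w ++ s)) : (windowFree w m).Nonempty := by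
  have hval : ∀ j : ℕ, (hj : j < (p ++ w ++ s).length) →
      (p ++ w ++ s)[j]?.getD ⟨0, hd⟩ = (p ++ w ++ s)[j] := by
    intro j hj
    rw [List.getElem?_eq_getElem hj, Option.getD_some]
  refine ⟨fun i => (p ++ w ++ s)[(i + m).toNat]?.getD ⟨0, hd⟩, ?_, ?_⟩
  · intro t ht
    have h : ((t : ℤ) + m).toNat = p.length + t := by omega
    simp only [h]
    rw [List.append_assoc, List.getElem?_append_right (by omega),
      Nat.add_sub_cancel_left, List.getElem?_append_left ht, List.getElem?_eq_getElem ht,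
      Option.getD_some]
  · intro i ℓ hℓ h1 h2
    have hl : (p ++ w ++ s).length = m + w.length + m := by simp [hp, hs, add_assoc]
    obtain ⟨t, ht, hne⟩ := hfree (i + m).toNat ℓ hℓ (by omega)
    refine ⟨t, ht, ?_⟩
    have e1 : (i + t + m).toNat = (i + m).toNat + t := by omega
    have e2 : (i + t + ℓ + m).toNat = (i + m).toNat + t + ℓ := by omega
    simp only [e1, e2]
    rw [hval _ (by omega), hval _ (by omega)]
    rw [List.getElem?_eq_getElem (by omega), List.getElem?_eq_getElem (by omega)] at hne
    exact fun h => hne (congrArg some h)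

/-- A word of length `n` extending far enough on both sides to a twelfth-power-free word lies in
the language. -/
lemma exists_margin {d : ℕ} (hd : 0 < d) {β : ℝ} (hβ : 12 ≤ β) (n : ℕ) :
    ∃ m : ℕ, ∀ p w s : List (Fin d), p.length = m → s.length = m → w.length = n →
      TwelveFree (p ++ w ++ s) → w ∈ langN (betaFree d β) n := by
  have hex : ∀ w : List (Fin d), ∃ m : ℕ, w ∉ language (betaFree d β) →
      ¬ (windowFree w m).Nonempty := by
    intro w
    by_contra! hc
    exact (hc 0).1 (mem_language_of_windowFree hβ fun m => (hc m).2)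
  choose f hf using hex
  set W := (List.finite_length_eq (Fin d) n).toFinset
  refine ⟨W.sup f, fun p w s hp hs hw hfree => ⟨?_, hw⟩⟩
  by_contra hcon
  apply hf w hcon
  obtain ⟨x, hx⟩ := windowFree_nonempty hd hp hs hfree
  have hle : f w ≤ W.sup f := Finset.le_sup (by simpa [W] using hw)
  exact ⟨x, hx.1, fun i ℓ hℓ h1 h2 => hx.2 i ℓ hℓ (by omega) (by omega)⟩

lemma langN_finite {d : ℕ} (X : Set (ℤ → Fin d)) (n : ℕ) : (langN X n).Finite :=
  (List.finite_length_eq (Fin d) n).subset fun _ hw => hw.2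

lemma ncard_image2_append_le {A : Type*} {S T : Set (List A)} (hS : S.Finite) (hT : T.Finite) :
    (image2 (· ++ ·) S T).ncard ≤ S.ncard * T.ncard := by
  rw [← image_prod, ← ncard_prod]
  exact ncard_image_le (hS.prod hT)

lemma exists_ncard_twelveFreeN_le {d : ℕ} (hd : 0 < d) {β : ℝ} (hβ : 12 ≤ β) (n : ℕ) :
    ∃ m : ℕ, ∀ k : ℕ, (twelveFreeN d (m + (k * n + m))).ncard ≤
      d ^ (2 * m) * (langN (betaFree d β) n).ncard ^ k := by
  obtain ⟨m, hm⟩ := exists_margin hd hβ n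
  refine ⟨m, fun k => ?_⟩
  set Q : ℕ → Set (List (Fin d)) := fun k =>
    {y | y.length = k * n + m ∧ ∃ p : List (Fin d), p.length = m ∧ TwelveFree (p ++ y)} with hQ
  have hQfin : ∀ k, (Q k).Finite := fun k =>
    (List.finite_length_eq (Fin d) (k * n + m)).subset fun _ hy => hy.1
  have hstep : ∀ k, Q (k + 1) ⊆ image2 (· ++ ·) (langN (betaFree d β) n) (Q k) := by
    rintro k y ⟨hy, p, hp, hfree⟩
    rw [add_mul, one_mul] at hy
    refine ⟨y.take n, ?_, y.drop n, ?_, List.take_append_drop n y⟩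
    · refine hm p (y.take n) ((y.drop n).take m) hp (by simp; omega) (by simp; omega) ?_
      have := hfree.take (p.length + (n + m))
      rwa [List.take_length_add_append, List.take_add, ← List.append_assoc] at this
    · refine ⟨by simp; omega, (p ++ y.take n).drop n, by simp; omega, ?_⟩
      have := hfree.drop n
      rw [← List.take_append_drop n y, ← List.append_assoc, List.drop_append_of_le_length] at this
      · exact this
      · simp; omega
  have hQcard : ∀ k, (Q k).ncard ≤ d ^ m * (langN (betaFree d β) n).ncard ^ k := by
    intro k
    induction k with
    | zero =>
      rw [pow_zero, mul_one, ← ncard_length_eq]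
      exact ncard_le_ncard (fun y hy => by simpa using hy.1) (List.finite_length_eq _ _)
    | succ k ih =>
      calc (Q (k + 1)).ncard ≤ _ :=
            ncard_le_ncard (hstep k) ((langN_finite _ _).image2 _ (hQfin k))
        _ ≤ _ := ncard_image2_append_le (langN_finite _ _) (hQfin k)
        _ ≤ _ := Nat.mul_le_mul_left _ ih
        _ = _ := by ring
  have hsub : twelveFreeN d (m + (k * n + m)) ⊆
      image2 (· ++ ·) {p : List (Fin d) | p.length = m} (Q k) := by
    rintro z ⟨hfree, hlen⟩
    refine ⟨z.take m, by simp; omega, z.drop m, ⟨by simp; omega, z.take m, by simp; omega, ?_⟩,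
      List.take_append_drop m z⟩
    rwa [List.take_append_drop]
  have hfin := List.finite_length_eq (Fin d) m
  calc _ ≤ _ := ncard_le_ncard hsub (hfin.image2 _ (hQfin k))
    _ ≤ _ := ncard_image2_append_le hfin (hQfin k)
    _ ≤ d ^ m * (d ^ m * (langN (betaFree d β) n).ncard ^ k) := by
      rw [ncard_length_eq]
      exact Nat.mul_le_mul_left _ (hQcard k)
    _ = _ := by ring

lemma le_of_pow_le_const_mul_pow {a b D : ℝ} (hb : 0 ≤ b)
    (h : ∀ k : ℕ, a ^ k ≤ D * b ^ k) : a ≤ b := by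
  by_contra! hab
  rcases hb.eq_or_lt with rfl | hb
  · have := h 1
    simp at this
    linarith
  · have h1 : 1 < a / b := (one_lt_div hb).2 hab
    obtain ⟨k, hk⟩ := pow_unbounded_of_one_lt D h1
    rw [div_pow, lt_div_iff₀ (by positivity)] at hk
    exact absurd (h k) (not_le.2 hk)

lemma pow_le_ncard_langN {d : ℕ} (hd : 2 ≤ d) {β : ℝ} (hβ : 12 ≤ β) (n : ℕ) :
    (3 / 4 * d : ℝ) ^ n ≤ (langN (betaFree d β) n).ncard := by
  have hd' : (2 : ℝ) ≤ d := by exact_mod_cast hd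
  obtain ⟨m, hm⟩ := exists_ncard_twelveFreeN_le (by omega : 0 < d) hβ n
  refine le_of_pow_le_const_mul_pow (D := (d : ℝ) ^ (2 * m)) (by positivity) fun k => ?_
  calc ((3 / 4 * d : ℝ) ^ n) ^ k = (3 / 4 * d : ℝ) ^ (k * n) := by rw [← pow_mul, mul_comm n]
    _ ≤ (3 / 4 * d : ℝ) ^ (m + (k * n + m)) := pow_le_pow_right₀ (by linarith) (by omega)
    _ ≤ (twelveFreeN d (m + (k * n + m))).ncard := pow_le_ncard_twelveFreeN hd _
    _ ≤ _ := by exact_mod_cast hm k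

/-- The words of length `n` that are concatenations of 4-powers. -/
def fourPowerWords (d n : ℕ) : Set (List (Fin d)) :=
  {w | w.length = n ∧ ∃ ps : List (List (Fin d)), (∀ p ∈ ps, IsFourPower p) ∧ w = ps.flatten}

lemma fourPowerWords_finite (d n : ℕ) : (fourPowerWords d n).Finite :=
  (List.finite_length_eq (Fin d) n).subset fun _ hw => hw.1

lemma ncard_fourPowerWords_le (d : ℕ) {n : ℕ} (hn : 0 < n) :
    (fourPowerWords d n).ncard ≤
      ∑ ℓ ∈ Finset.Icc 1 n with 4 * ℓ ≤ n, d ^ ℓ * (fourPowerWords d (n - 4 * ℓ)).ncard := by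
  set I := (Finset.Icc 1 n).filter fun ℓ => 4 * ℓ ≤ n with hI
  set B : ℕ → Set (List (Fin d)) := fun ℓ =>
    (fun q : List (Fin d) × List (Fin d) => q.1 ++ q.1 ++ q.1 ++ q.1 ++ q.2) ''
      ({v | v.length = ℓ} ×ˢ fourPowerWords d (n - 4 * ℓ)) with hB
  have hfin : ∀ ℓ, ({v : List (Fin d) | v.length = ℓ} ×ˢ fourPowerWords d (n - 4 * ℓ)).Finite :=
    fun ℓ => (List.finite_length_eq (Fin d) ℓ).prod (fourPowerWords_finite d _)
  have hcover : fourPowerWords d n ⊆ ⋃ ℓ ∈ I, B ℓ := by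
    rintro w ⟨hlen, ps, hps, rfl⟩
    cases ps with
    | nil => simp at hlen; omega
    | cons p ps =>
      obtain ⟨v, hv, rfl⟩ := hps p (by simp)
      have hv' := List.length_pos_iff.2 hv
      simp only [List.flatten_cons, List.length_append] at hlen
      simp only [mem_iUnion]
      refine ⟨v.length, ?_, (v, ps.flatten), ⟨rfl, ?_, ps, ?_, rfl⟩, by simp⟩
      · simp only [hI, Finset.mem_filter, Finset.mem_Icc]
        omega
      · simp only
        omega
      · exact fun q hq => hps q (by simp [hq])
  calc _ ≤ _ := ncard_le_ncard hcover (I.finite_toSet.biUnion fun ℓ _ => (hfin ℓ).image _)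
    _ ≤ _ := Finset.set_ncard_biUnion_le I B
    _ ≤ _ := by
      refine Finset.sum_le_sum fun ℓ _ => ?_
      refine (ncard_image_le (hfin ℓ)).trans ?_
      rw [ncard_prod, ncard_length_eq]

lemma ncard_fourPowerWords_le_pow {d : ℕ} {ρ : ℝ} (hρ0 : 0 ≤ ρ) (hρ : 2 * d ≤ ρ ^ 4) (n : ℕ) :
    ((fourPowerWords d n).ncard : ℝ) ≤ ρ ^ n := by
  induction n using Nat.strong_induction_on with
  | _ n ih =>
    rcases Nat.eq_zero_or_pos n with rfl | hn
    · have h := ncard_le_ncard (s := fourPowerWords d 0) (t := {w | w.length = 0})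
        (fun w hw => hw.1) (List.finite_length_eq _ _)
      rw [ncard_length_eq] at h
      simpa using h
    have hterm : ∀ ℓ ∈ (Finset.Icc 1 n).filter (fun ℓ => 4 * ℓ ≤ n),
        (d : ℝ) ^ ℓ * (fourPowerWords d (n - 4 * ℓ)).ncard ≤ (1 / 2) ^ ℓ * ρ ^ n := by
      intro ℓ hℓ
      simp only [Finset.mem_filter, Finset.mem_Icc] at hℓ
      calc (d : ℝ) ^ ℓ * (fourPowerWords d (n - 4 * ℓ)).ncard
          ≤ (1 / 2 * ρ ^ 4) ^ ℓ * ρ ^ (n - 4 * ℓ) := by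
            gcongr
            · linarith
            · exact ih _ (by omega)
        _ = (1 / 2) ^ ℓ * ρ ^ n := by
            rw [mul_pow, mul_assoc, ← pow_mul, ← pow_add, Nat.add_sub_cancel' hℓ.2]
    calc ((fourPowerWords d n).ncard : ℝ) ≤ ∑ ℓ ∈ Finset.Icc 1 n with 4 * ℓ ≤ n,
            (d : ℝ) ^ ℓ * (fourPowerWords d (n - 4 * ℓ)).ncard := by
          exact_mod_cast ncard_fourPowerWords_le d hn
      _ ≤ ∑ ℓ ∈ Finset.Icc 1 n with 4 * ℓ ≤ n, (1 / 2 : ℝ) ^ ℓ * ρ ^ n :=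
          Finset.sum_le_sum hterm
      _ ≤ ∑ ℓ ∈ Finset.Icc 1 n, (1 / 2 : ℝ) ^ ℓ * ρ ^ n :=
          Finset.sum_le_sum_of_subset_of_nonneg (Finset.filter_subset _ _)
            fun _ _ _ => by positivity
      _ ≤ 1 * ρ ^ n := by
          rw [← Finset.sum_mul]
          gcongr
          exact (sum_Icc_pow_le (by norm_num) (by norm_num) n).trans (by norm_num)
      _ = ρ ^ n := one_mul _

/-- Entropy gap: the concatenations of 4-powers have exponential growth rate
strictly smaller than the topological entropy. -/
theorem entropy_gap_beta_free (d : ℕ) (β : ℝ)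
    (hcase : (3 ≤ d ∧ 12 ≤ β) ∨ (d = 2 ∧ 12 < β)) (h : ℝ)
    (hEnt : Tendsto (fun n : ℕ => Real.log ((langN (betaFree d β) n).ncard) / n)
      atTop (nhds h)) :
    Filter.limsup
      (fun n : ℕ =>
        Real.log (({w ∈ fourPowerConcat (betaFree d β) | w.length = n}).ncard) / n)
      atTop < h := by
  have hd : 2 ≤ d := by omega
  have hβ : 12 ≤ β := by rcases hcase with h | h <;> linarith [h.2]
  have hd' : (2 : ℝ) ≤ d := by exact_mod_cast hd
  have hlower : Real.log (3 / 4 * d) ≤ h := by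
    refine ge_of_tendsto hEnt ?_
    filter_upwards [eventually_gt_atTop 0] with n hn
    have hn' : (0 : ℝ) < n := by exact_mod_cast hn
    rw [le_div_iff₀ hn', mul_comm, ← Real.log_pow]
    exact Real.log_le_log (by positivity) (pow_le_ncard_langN hd hβ n)
  have hρ : (2 * d : ℝ) ≤ (18 / 25 * d) ^ 4 := by
    have h3 : (2 : ℝ) ^ 3 ≤ (d : ℝ) ^ 3 := by gcongr
    calc (2 * d : ℝ) ≤ (18 / 25) ^ 4 * 2 ^ 3 * d := by gcongr; norm_num
      _ ≤ (18 / 25) ^ 4 * (d : ℝ) ^ 3 * d := by gcongr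
      _ = _ := by ring
  refine lt_of_le_of_lt (b := Real.log (18 / 25 * d)) ?_
    (lt_of_lt_of_le (Real.log_lt_log (by positivity) (by linarith)) hlower)
  refine limsup_le_of_le ?_ ?_
  · exact isCoboundedUnder_le_of_le atTop (x := 0) fun n =>
      div_nonneg (Real.log_natCast_nonneg _) (Nat.cast_nonneg n)
  filter_upwards [eventually_gt_atTop 0] with n hn
  have hn' : (0 : ℝ) < n := by exact_mod_cast hn
  set c := ({w ∈ fourPowerConcat (betaFree d β) | w.length = n}).ncard with hc
  have hcle : (c : ℝ) ≤ (18 / 25 * d) ^ n := by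
    refine le_trans ?_ (ncard_fourPowerWords_le_pow (by positivity) hρ n)
    rw [hc, Nat.cast_le]
    refine ncard_le_ncard ?_ (fourPowerWords_finite d n)
    rintro w ⟨⟨-, ps, hps, rfl⟩, hlen⟩
    refine ⟨hlen, ps, fun p hp => ?_, rfl⟩
    obtain ⟨v, -, hv⟩ := hps p hp
    exact ⟨v, hv⟩
  rw [div_le_iff₀ hn', mul_comm, ← Real.log_pow]
  rcases Nat.eq_zero_or_pos c with h0 | h0
  · rw [h0, Nat.cast_zero, Real.log_zero]
    exact Real.log_nonneg (one_le_pow₀ (by linarith))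
  · exact Real.log_le_log (by exact_mod_cast h0) hcle
end

section
/- Let d ≥ 2 be an integer and β ≥ 16 a real number, and let L and G be the language and good-word collection of X^d_β. Then for every u, v, w, x ∈ G, the concatenation uvwx belongs to L. -/
open MeasureTheory Filter Real Set

/-- The stretch of `f` on `[i, j)` has period `ℓ`. -/
def PeriodicOn {A : Type*} (f : ℤ → A) (i j ℓ : ℤ) : Prop :=
  ∀ t, i ≤ t → t + ℓ < j → f t = f (t + ℓ)

theorem PeriodicOn.mono {A : Type*} {f : ℤ → A} {i j i' j' ℓ : ℤ} (h : PeriodicOn f i j ℓ)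
    (hi : i ≤ i') (hj : j' ≤ j) : PeriodicOn f i' j' ℓ :=
  fun t h₁ h₂ => h t (by omega) (by omega)

theorem PeriodicOn.congr {A : Type*} {f g : ℤ → A} {i j ℓ : ℤ} (h : PeriodicOn f i j ℓ)
    (hℓ : 0 ≤ ℓ) (hfg : ∀ t, i ≤ t → t < j → f t = g t) : PeriodicOn g i j ℓ := by
  intro t h₁ h₂
  rw [← hfg t h₁ (by omega), ← hfg (t + ℓ) (by omega) h₂, h t h₁ h₂]

theorem PeriodicOn.reflect {A : Type*} {f : ℤ → A} {i j ℓ : ℤ} (c : ℤ)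
    (h : PeriodicOn (fun t => f (c - t)) i j ℓ) :
    PeriodicOn f (c + 1 - j) (c + 1 - i) ℓ := by
  intro t h₁ h₂
  have := h (c - (t + ℓ)) (by omega) (by omega)
  simp only [show c - (c - (t + ℓ)) = t + ℓ by ring,
    show c - (c - (t + ℓ) + ℓ) = t by ring] at this
  exact this.symm

/-- Every periodic stretch of `f` that meets the block `[a, b)` and is not strictly inside it
covers fewer than four periods of the block. -/
def BoundaryFourFree {A : Type*} (f : ℤ → A) (a b : ℤ) : Prop :=
  ∀ i j ℓ : ℤ, 1 ≤ ℓ → PeriodicOn f i j ℓ → i ≤ a ∨ b ≤ j → min j b - max i a < 4 * ℓ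

theorem BoundaryFourFree.reflect {A : Type*} {f : ℤ → A} {a b : ℤ} (h : BoundaryFourFree f a b)
    (c : ℤ) : BoundaryFourFree (fun t => f (c - t)) (c + 1 - b) (c + 1 - a) := by
  intro i j ℓ hℓ hp hij
  have := h _ _ ℓ hℓ (hp.reflect c) (by omega)
  omega

theorem isFourPower_of_getElem_eq {A : Type*} {s : List A} {ℓ : ℕ} (hℓ : 1 ≤ ℓ)
    (hs : s.length = 4 * ℓ)
    (h : ∀ t : ℕ, (ht : t + ℓ < s.length) → s[t] = s[t + ℓ]) : IsFourPower s := by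
  refine ⟨s.take ℓ, ?_, ?_⟩
  · intro h0
    have := congrArg List.length h0
    simp only [List.length_take, List.length_nil] at this
    omega
  · apply List.ext_getElem
    · simp
      omega
    · intro t h₁ h₂
      simp only [List.getElem_append, List.length_append, List.length_take, List.getElem_take]
      have key : ∀ k t : ℕ, (ht : t + k * ℓ < s.length) → s[t]'(by omega) = s[t + k * ℓ] := by
        intro k
        induction k with
        | zero => intro t ht; simp
        | succ k ih =>
          intro t ht
          have e : t + (k + 1) * ℓ = t + k * ℓ + ℓ := by ring
          rw [ih t (by omega), h (t + k * ℓ) (by omega)]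
          simp only [e]
      have k1 := key 1 (t - ℓ)
      have k2 := key 2 (t - 2 * ℓ)
      have k3 := key 3 (t - 3 * ℓ)
      split_ifs
      · rfl
      · symm; convert k1 (by omega) using 2 <;> omega
      · symm; convert k2 (by omega) using 2 <;> omega
      · symm; convert k3 (by omega) using 2 <;> omega

theorem boundaryFourFree_of_mem_goodWords {A : Type*} {X : Set (ℤ → A)} {u : List A}
    (hu : u ∈ goodWords X) {f : ℤ → A} {a b : ℤ} (hb : b = a + u.length)
    (hf : ∀ t : ℕ, (ht : t < u.length) → f (a + t) = u[t]) : BoundaryFourFree f a b := by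
  intro i j ℓ hℓ hp hij
  by_contra! hlt
  lift ℓ to ℕ using by omega
  obtain ⟨-, hpre, hsuf⟩ := hu
  have hlen : 4 * ℓ ≤ u.length := by omega
  rcases hij with h | h
  · refine hpre _ ⟨_, List.take_append_drop (4 * ℓ) u⟩
      (isFourPower_of_getElem_eq (ℓ := ℓ) (by omega) (by simpa using hlen) ?_)
    intro t ht
    simp only [List.length_take] at ht
    simp only [List.getElem_take]
    rw [← hf t (by omega), ← hf (t + ℓ) (by omega), hp (a + t) (by omega) (by omega)]
    congr 1
    push_cast
    ring
  · refine hsuf _ (List.drop_suffix (u.length - 4 * ℓ) u)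
      (isFourPower_of_getElem_eq (ℓ := ℓ) (by omega) (by simp; omega) ?_)
    intro t ht
    simp only [List.length_drop] at ht
    simp only [List.getElem_drop]
    rw [← hf _ (by omega), ← hf _ (by omega), hp _ (by omega) (by omega)]
    congr 1
    push_cast
    ring

/-- Among four consecutive blocks, at most one `ℓ` is the period of a prefix of length `12 * ℓ`. -/
theorem periodic_start_unique {A : Type*} {f : ℤ → A} {n₁ n₂ n₃ n₄ : ℤ}
    (h₁ : 0 ≤ n₁) (h₂ : n₁ ≤ n₂) (h₃ : n₂ ≤ n₃)
    (b₁ : BoundaryFourFree f 0 n₁) (b₂ : BoundaryFourFree f n₁ n₂)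
    (b₃ : BoundaryFourFree f n₂ n₃) (b₄ : BoundaryFourFree f n₃ n₄)
    {k ℓ : ℤ} (hk : 1 ≤ k) (hkℓ : k < ℓ) (hℓ : 12 * ℓ ≤ n₄)
    (pk : PeriodicOn f 0 (12 * k) k) (pℓ : PeriodicOn f 0 (12 * ℓ) ℓ) : False := by
  have u₁ := b₁ _ _ _ hk pk (by omega)
  have u₂ := b₂ _ _ _ hk pk (by omega)
  have u₃ := b₃ _ _ _ hk pk (by omega)
  have v₄ := b₄ _ _ _ (by omega) pℓ (by omega)
  have pm : PeriodicOn f 0 (11 * k) (ℓ - k) := by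
    intro t ht₁ ht₂
    rw [pℓ t ht₁ (by omega), pk (t + (ℓ - k)) (by omega) (by omega)]
    congr 1
    ring
  have w₁ := b₁ _ _ _ (by omega) pm (by omega)
  have w₂ := b₂ _ _ _ (by omega) pm (by omega)
  have w₃ := b₃ _ _ _ (by omega) pm (by omega)
  have w₄ := b₄ _ _ _ (by omega) pm (by omega)
  omega

theorem exists_letter_breaking_prefix_periods {A : Type*} [Nontrivial A] {f : ℤ → A}
    {n₁ n₂ n₃ n₄ : ℤ} (h₁ : 0 ≤ n₁) (h₂ : n₁ ≤ n₂) (h₃ : n₂ ≤ n₃)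
    (b₁ : BoundaryFourFree f 0 n₁) (b₂ : BoundaryFourFree f n₁ n₂)
    (b₃ : BoundaryFourFree f n₂ n₃) (b₄ : BoundaryFourFree f n₃ n₄) :
    ∃ a : A, ∀ ℓ : ℤ, 1 ≤ ℓ → 12 * ℓ ≤ n₄ → PeriodicOn f 0 (12 * ℓ) ℓ → a ≠ f (ℓ - 1) := by
  by_cases h : ∃ ℓ : ℤ, 1 ≤ ℓ ∧ 12 * ℓ ≤ n₄ ∧ PeriodicOn f 0 (12 * ℓ) ℓ
  · obtain ⟨k, hk, hk₄, pk⟩ := h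
    obtain ⟨a, ha⟩ := exists_ne (f (k - 1))
    refine ⟨a, fun ℓ hℓ hℓ₄ pℓ => ?_⟩
    rcases lt_trichotomy k ℓ with hlt | rfl | hlt
    · exact (periodic_start_unique h₁ h₂ h₃ b₁ b₂ b₃ b₄ hk hlt hℓ₄ pk pℓ).elim
    · exact ha
    · exact (periodic_start_unique h₁ h₂ h₃ b₁ b₂ b₃ b₄ hℓ hlt hk₄ pℓ pk).elim
  · push Not at h
    exact ⟨f 0, fun ℓ hℓ hℓ₄ pℓ => (h ℓ hℓ hℓ₄ pℓ).elim⟩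

/-- The Thue–Morse sequence. -/
def thueMorse (n : ℕ) : Bool :=
  if n = 0 then false else xor (thueMorse (n / 2)) (decide (n % 2 = 1))
decreasing_by omega

theorem thueMorse_two_mul (n : ℕ) : thueMorse (2 * n) = thueMorse n := by
  rcases Nat.eq_zero_or_pos n with rfl | hn
  · rfl
  · rw [thueMorse, if_neg (by omega)]
    simp

theorem thueMorse_two_mul_add_one (n : ℕ) : thueMorse (2 * n + 1) = !thueMorse n := by
  rw [thueMorse, if_neg (by omega), show (2 * n + 1) / 2 = n by omega]
  simp [Nat.add_mod]

theorem thueMorse_overlapFree (ℓ : ℕ) (hℓ : 1 ≤ ℓ) (i : ℕ)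
    (h : ∀ t, t ≤ ℓ → thueMorse (i + t) = thueMorse (i + t + ℓ)) : False := by
  induction ℓ using Nat.strong_induction_on generalizing i with
  | _ ℓ ih =>
  rcases Nat.even_or_odd' ℓ with ⟨k, rfl | rfl⟩
  · refine ih k (by omega) (by omega) (i / 2) fun t ht => ?_
    have := h (2 * t) (by omega)
    rcases Nat.even_or_odd' i with ⟨r, rfl | rfl⟩
    · rw [← Nat.mul_add, ← Nat.mul_add, thueMorse_two_mul, thueMorse_two_mul] at this
      rw [Nat.mul_div_cancel_left _ (by omega), this]
    · rw [show 2 * r + 1 + 2 * t = 2 * (r + t) + 1 by ring,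
        show 2 * (r + t) + 1 + 2 * k = 2 * (r + t + k) + 1 by ring,
        thueMorse_two_mul_add_one, thueMorse_two_mul_add_one] at this
      rw [show (2 * r + 1) / 2 = r by omega]
      simpa using this
  · have step : ∀ m, thueMorse (2 * m + 1) = !thueMorse (2 * m) := fun m => by
      rw [thueMorse_two_mul_add_one, thueMorse_two_mul]
    have alt : ∀ t, t < 2 * k + 1 → thueMorse (i + (t + 1)) = !thueMorse (i + t) := by
      intro t ht
      rcases Nat.even_or_odd' (i + t) with ⟨m, hm | hm⟩
      · rw [← Nat.add_assoc, hm, step]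
      · rw [h t (by omega), h (t + 1) (by omega),
          show i + t + (2 * k + 1) = 2 * (m + k + 1) by omega,
          show i + (t + 1) + (2 * k + 1) = 2 * (m + k + 1) + 1 by omega, step]
    have par : ∀ t, t ≤ k → thueMorse (i + 2 * t) = thueMorse i := by
      intro t
      induction t with
      | zero => intro _; rfl
      | succ t iht =>
        intro ht
        have e₁ := alt (2 * t) (by omega)
        have e₂ := alt (2 * t + 1) (by omega)
        rw [show 2 * (t + 1) = 2 * t + 1 + 1 by ring, e₂, e₁, iht (by omega), Bool.not_not]
    have e₀ := h 0 (by omega)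
    have e₁ := alt (2 * k) (by omega)
    rw [par k le_rfl] at e₁
    rw [Nat.add_zero, e₁] at e₀
    simp at e₀

/-- An infinite overlap-free ray with prescribed initial letter. -/
theorem exists_overlapFree_ray {A : Type*} [Nontrivial A] (a : A) :
    ∃ z : ℤ → A, z 0 = a ∧
      ∀ i j ℓ : ℤ, 0 ≤ i → 1 ≤ ℓ → PeriodicOn z i j ℓ → j - i ≤ 2 * ℓ := by
  obtain ⟨b, hb⟩ := exists_ne a
  refine ⟨fun t => if thueMorse t.toNat then b else a, by simp [thueMorse], ?_⟩
  intro i j ℓ hi hℓ hp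
  by_contra! hlt
  lift i to ℕ using hi
  lift ℓ to ℕ using by omega
  refine thueMorse_overlapFree ℓ (by omega) i fun t ht => ?_
  have := hp (i + t) (by omega) (by omega)
  simp only [← Nat.cast_add, Int.toNat_natCast] at this
  cases h₁ : thueMorse (i + t) <;> cases h₂ : thueMorse (i + t + ℓ)
  · rfl
  · simp only [h₁, h₂] at this
    exact absurd this.symm hb
  · simp only [h₁, h₂] at this
    exact absurd this hb
  · rfl

/-- A four-block stretch extends to a bi-infinite sequence all of whose periodic stretches
outside single blocks have exponent below `16`. -/
theorem exists_extension_of_four_blocks {A : Type*} [Nontrivial A] {f : ℤ → A}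
    {n₁ n₂ n₃ n₄ : ℤ} (h₁ : 0 ≤ n₁) (h₂ : n₁ ≤ n₂) (h₃ : n₂ ≤ n₃) (h₄ : n₃ ≤ n₄)
    (b₁ : BoundaryFourFree f 0 n₁) (b₂ : BoundaryFourFree f n₁ n₂)
    (b₃ : BoundaryFourFree f n₂ n₃) (b₄ : BoundaryFourFree f n₃ n₄) :
    ∃ y : ℤ → A, (∀ t, 0 ≤ t → t < n₄ → y t = f t) ∧
      ∀ i j ℓ : ℤ, 1 ≤ ℓ → 16 * ℓ ≤ j - i → PeriodicOn y i j ℓ →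
        (0 ≤ i ∧ j ≤ n₁) ∨ (n₁ ≤ i ∧ j ≤ n₂) ∨ (n₂ ≤ i ∧ j ≤ n₃) ∨ (n₃ ≤ i ∧ j ≤ n₄) := by
  obtain ⟨a, ha⟩ := exists_letter_breaking_prefix_periods h₁ h₂ h₃ b₁ b₂ b₃ b₄
  have r : ∀ {p q p' q' : ℤ}, BoundaryFourFree f p q → p' = n₄ - q → q' = n₄ - p →
      BoundaryFourFree (fun t => f (n₄ - 1 - t)) p' q' := by
    intro p q p' q' h hp hq
    have := h.reflect (n₄ - 1)
    rwa [show n₄ - 1 + 1 - q = p' by omega, show n₄ - 1 + 1 - p = q' by omega] at this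
  obtain ⟨b, hb⟩ := exists_letter_breaking_prefix_periods (n₁ := n₄ - n₃) (n₂ := n₄ - n₂)
    (n₃ := n₄ - n₁) (n₄ := n₄) (by omega) (by omega) (by omega)
    (r b₄ (by omega) rfl) (r b₃ rfl rfl) (r b₂ rfl rfl) (r b₁ rfl (by omega))
  obtain ⟨z, hz₀, hz⟩ := exists_overlapFree_ray a
  obtain ⟨z', hz₀', hz'⟩ := exists_overlapFree_ray b
  set y : ℤ → A := fun t => if t < 0 then z (-1 - t) else if t < n₄ then f t else z' (t - n₄)
    with hy
  have yl : ∀ t, t < 0 → y t = z (-1 - t) := fun t ht => by simp [hy, ht]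
  have ym : ∀ t, 0 ≤ t → t < n₄ → y t = f t := fun t ht ht' => by
    simp [hy, ht', not_lt.2 ht]
  have yr : ∀ t, n₄ ≤ t → y t = z' (t - n₄) := fun t ht => by
    simp [hy, not_lt.2 ht, show ¬ t < 0 by omega]
  have left : ∀ i j ℓ : ℤ, 1 ≤ ℓ → j ≤ 0 → PeriodicOn y i j ℓ → j - i ≤ 2 * ℓ := by
    intro i j ℓ hℓ hj hp
    have := hz (-j) (-i) ℓ (by omega) hℓ (fun t ht₁ ht₂ => by
      have := hp (-1 - (t + ℓ)) (by omega) (by omega)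
      rw [yl _ (by omega), yl _ (by omega)] at this
      convert this.symm using 2 <;> ring)
    omega
  have right : ∀ i j ℓ : ℤ, 1 ≤ ℓ → n₄ ≤ i → PeriodicOn y i j ℓ → j - i ≤ 2 * ℓ := by
    intro i j ℓ hℓ hi hp
    have := hz' (i - n₄) (j - n₄) ℓ (by omega) hℓ (fun t ht₁ ht₂ => by
      have := hp (t + n₄) (by omega) (by omega)
      rw [yr _ (by omega), yr _ (by omega)] at this
      convert this using 2 <;> ring)
    omega
  refine ⟨y, ym, fun i j ℓ hℓ hij hp => ?_⟩
  have hl := left i (min j 0) ℓ hℓ (by omega) (hp.mono le_rfl (by omega))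
  have hr := right (max i n₄) j ℓ hℓ (by omega) (hp.mono (by omega) le_rfl)
  have hmid : PeriodicOn f (max i 0) (min j n₄) ℓ :=
    (hp.mono (by omega) (by omega)).congr (by omega) fun t ht₁ ht₂ => ym t (by omega) (by omega)
  rcases lt_or_ge i 0 with hi | hi
  · have e := hp (-1) (by omega) (by omega)
    rw [yl _ (by omega), ym _ (by omega) (by omega), show (-1 : ℤ) - -1 = 0 by ring, hz₀,
      show -1 + ℓ = ℓ - 1 by ring] at e
    exact (ha ℓ hℓ (by omega) (hmid.mono (by omega) (by omega)) e).elim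
  rcases lt_or_ge n₄ j with hj | hj
  · have e := hp (n₄ - ℓ) (by omega) (by omega)
    rw [ym _ (by omega) (by omega), yr _ (by omega), show n₄ - ℓ + ℓ - n₄ = 0 by ring, hz₀'] at e
    refine (hb ℓ hℓ (by omega) ?_ ?_).elim
    · intro t ht₁ ht₂
      have := hmid (n₄ - 1 - (t + ℓ)) (by omega) (by omega)
      convert this.symm using 2
      ring
    · rw [← e]
      congr 1
      ring
  have c₁ := b₁ _ _ ℓ hℓ hmid
  have c₂ := b₂ _ _ ℓ hℓ hmid
  have c₃ := b₃ _ _ ℓ hℓ hmid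
  have c₄ := b₄ _ _ ℓ hℓ hmid
  omega

theorem length_lt_of_inside_language_block {d : ℕ} {β : ℝ} {u s : List (Fin d)}
    (hu : u ∈ language (betaFree d β)) {y : ℤ → Fin d} {a i : ℤ}
    (hy : ∀ t : ℕ, (ht : t < u.length) → y (a + t) = u[t])
    (hs : ∀ t : ℕ, (ht : t < s.length) → y (i + t) = s[t])
    (hai : a ≤ i) (his : i + s.length ≤ a + u.length) {ℓ : ℕ} (hp : HasPeriodN s ℓ) :
    (s.length : ℝ) < β * ℓ := by
  obtain ⟨x, hx, k, hk⟩ := hu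
  refine hx s ⟨k + (i - a), fun t ht => ?_⟩ ℓ hp
  obtain ⟨c, hc⟩ := Int.eq_ofNat_of_zero_le (sub_nonneg.2 hai)
  have h₁ := hk (c + t) (by omega)
  have h₂ := hy (c + t) (by omega)
  rw [← hs t ht, hc, show i + (t : ℤ) = a + ((c + t : ℕ) : ℤ) by push_cast; omega, h₂, ← h₁]
  congr 1
  push_cast
  ring

/-- For `β ≥ 16`, any four good words concatenate to a word of the language. -/
theorem good_concat_four (d : ℕ) (hd : 2 ≤ d) (β : ℝ) (hβ : 16 ≤ β) :
    ∀ u v w x : List (Fin d),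
      u ∈ goodWords (betaFree d β) → v ∈ goodWords (betaFree d β) →
      w ∈ goodWords (betaFree d β) → x ∈ goodWords (betaFree d β) →
      u ++ v ++ w ++ x ∈ language (betaFree d β) := by
  intro u v w x hu hv hw hx
  have : Nontrivial (Fin d) := Fin.nontrivial_iff_two_le.2 hd
  have hd₀ : 0 < d := by omega
  set W := u ++ v ++ w ++ x with hW
  have hlen : W.length = u.length + v.length + w.length + x.length := by simp [hW]; omega
  set f : ℤ → Fin d := fun t => W.getD t.toNat ⟨0, hd₀⟩ with hf
  have block : ∀ p s q : List (Fin d), W = p ++ s ++ q → ∀ n : ℕ, n = p.length →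
      ∀ t : ℕ, (ht : t < s.length) → f ((n : ℤ) + t) = s[t] := by
    intro p s q hpq n hn t ht
    simp only [hf, hpq, ← Nat.cast_add, Int.toNat_natCast]
    rw [hn, List.append_assoc, List.getD_append_right _ _ _ _ (by omega),
      Nat.add_sub_cancel_left, List.getD_append _ _ _ _ ht, List.getD_eq_getElem _ _ ht]
  have fW := block [] W [] (by simp) 0 rfl
  have fu := block [] u (v ++ w ++ x) (by simp [hW]) 0 rfl
  have fv := block u v (w ++ x) (by simp [hW]) u.length rfl
  have fw := block (u ++ v) w x (by simp [hW]) (u.length + v.length) (by simp)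
  have fx := block (u ++ v ++ w) x [] (by simp [hW]) (u.length + v.length + w.length)
    (by simp only [List.length_append])
  obtain ⟨y, hyf, hy⟩ := exists_extension_of_four_blocks (by omega) (by omega) (by omega)
    (by omega)
    (boundaryFourFree_of_mem_goodWords hu (b := u.length) (by simp) fu)
    (boundaryFourFree_of_mem_goodWords hv (b := (u.length + v.length : ℕ)) (by omega) fv)
    (boundaryFourFree_of_mem_goodWords hw (b := (u.length + v.length + w.length : ℕ))
      (by omega) fw)
    (boundaryFourFree_of_mem_goodWords hx (b := W.length) (by omega) fx)
  refine ⟨y, ?_, 0, fun t ht => by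
    rw [hyf _ (by omega) (by omega)]
    exact fW t ht⟩
  rintro s ⟨i, hs⟩ ℓ hp
  by_contra! hlt
  have hℓ := hp.1
  have h16 : 16 * ℓ ≤ s.length := by
    have : (16 : ℝ) * ℓ ≤ s.length :=
      (mul_le_mul_of_nonneg_right hβ (Nat.cast_nonneg ℓ)).trans hlt
    exact_mod_cast this
  have per : PeriodicOn y i (i + s.length) ℓ := by
    intro t ht₁ ht₂
    obtain ⟨c, hc⟩ := Int.eq_ofNat_of_zero_le (sub_nonneg.2 ht₁)
    have e := hp.2.2 c (by omega)
    rw [← hs c (by omega), ← hs (c + ℓ) (by omega)] at e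
    convert e using 2 <;> push_cast <;> omega
  refine absurd hlt (not_le.2 ?_)
  rcases hy i (i + s.length) ℓ (by omega) (by omega) per with h | h | h | h
  · exact length_lt_of_inside_language_block hu.1 (a := (0 : ℕ))
      (fun t ht => by rw [hyf _ (by omega) (by omega), fu t ht]) hs (by omega) (by omega) hp
  · exact length_lt_of_inside_language_block hv.1 (a := u.length)
      (fun t ht => by rw [hyf _ (by omega) (by omega), fv t ht]) hs (by omega) (by omega) hp
  · exact length_lt_of_inside_language_block hw.1 (a := (u.length + v.length : ℕ))
      (fun t ht => by rw [hyf _ (by omega) (by omega), fw t ht]) hs (by omega) (by omega) hp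
  · exact length_lt_of_inside_language_block hx.1
      (a := (u.length + v.length + w.length : ℕ))
      (fun t ht => by rw [hyf _ (by omega) (by omega), fx t ht]) hs (by omega) (by omega) hp
end

section
/- Let X be a shift space on a finite alphabet with language L, and suppose G ⊆ L satisfies the same-length specification property: there exists τ ∈ ℕ such that for every n ≥ 1 and every v, w ∈ G of length n, there exists u ∈ L_τ with vuw ∈ G. Then, with the same τ: for every k, n ∈ ℕ and all words w⁽¹⁾, …, w⁽ᵏ⁾ ∈ G of length n, there exist u⁽¹⁾, …, u⁽ᵏ⁻¹⁾ ∈ L_τ such that the concatenation w⁽¹⁾u⁽¹⁾w⁽²⁾u⁽²⁾⋯u⁽ᵏ⁻¹⁾w⁽ᵏ⁾ ∈ L. -/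
open MeasureTheory Filter Real Set

theorem alternate_append {A : Type*} (ws ws' us us' : List (List A)) (u : List A)
    (h : ws.length = us.length + 1) :
    alternate (ws ++ ws') (us ++ u :: us') = alternate ws us ++ u ++ alternate ws' us' := by
  induction ws generalizing us with
  | nil => simp at h
  | cons w ws ih =>
    cases us with
    | nil =>
      obtain rfl : ws = [] := by simpa using h
      simp [alternate]
    | cons v vs =>
      have := ih vs (by simpa using h)
      simp [alternate, this]

theorem length_alternate {A : Type*} (ws us : List (List A)) (n τ : ℕ)
    (h : ws.length = us.length + 1) (hws : ∀ w ∈ ws, w.length = n)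
    (hus : ∀ u ∈ us, u.length = τ) :
    (alternate ws us).length = n + us.length * (τ + n) := by
  induction us generalizing ws with
  | nil =>
    obtain ⟨w, rfl⟩ := List.length_eq_one_iff.mp h
    simpa [alternate] using hws
  | cons u us ih =>
    cases ws with
    | nil => simp at h
    | cons w ws =>
      have hrec := ih ws (by simpa using h) (fun w hw => hws w (by simp [hw]))
        (fun v hv => hus v (by simp [hv]))
      simp only [alternate, List.length_append, List.length_cons, hrec, hws w (by simp),
        hus u (by simp)]
      ring

theorem alternate_prefix_append {A : Type*} (ws ws' us us' : List (List A))
    (h : ws.length = us.length + 1) :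
    alternate ws us <+: alternate (ws ++ ws') (us ++ us') := by
  cases us' with
  | cons u us' =>
    rw [alternate_append ws ws' us us' u h, List.append_assoc]
    exact List.prefix_append _ _
  | nil =>
    induction ws generalizing us with
    | nil => simp at h
    | cons w ws ih =>
      cases us with
      | nil => simp [alternate]
      | cons v vs =>
        simpa [alternate] using ih vs (by simpa using h)

theorem mem_language_of_prefix {A : Type*} {X : Set (ℤ → A)} {v w : List A}
    (hvw : v <+: w) (hw : w ∈ language X) : v ∈ language X := by
  obtain ⟨x, hx, i, hi⟩ := hw
  refine ⟨x, hx, i, fun t ht => ?_⟩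
  rw [hi t (ht.trans_le hvw.length_le), hvw.getElem ht]

/-- The word of length `n` read off `x` from position `i`. -/
def blockAt {A : Type*} (x : ℤ → A) (i : ℤ) (n : ℕ) : List A :=
  (List.range n).map fun t : ℕ => x (i + t)

theorem blockAt_mem_langN {A : Type*} {X : Set (ℤ → A)} {x : ℤ → A} (hx : x ∈ X)
    (i : ℤ) (n : ℕ) : blockAt x i n ∈ langN X n :=
  ⟨⟨x, hx, i, fun t ht => by simp [blockAt]⟩, by simp [blockAt]⟩

theorem blockAt_add {A : Type*} (x : ℤ → A) (i : ℤ) (m n : ℕ) :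
    blockAt x i (m + n) = blockAt x i m ++ blockAt x (i + m) n := by
  simp [blockAt, List.range_add, add_assoc]

theorem exists_alternate_nil_eq_blockAt {A : Type*} {X : Set (ℤ → A)} {x : ℤ → A}
    (hx : x ∈ X) (τ : ℕ) (ws : List (List A)) (hws : ∀ w ∈ ws, w = []) (i : ℤ) :
    ∃ us : List (List A), us.length = ws.length - 1 ∧ (∀ u ∈ us, u ∈ langN X τ) ∧
      ∃ n, alternate ws us = blockAt x i n := by
  induction ws generalizing i with
  | nil => exact ⟨[], rfl, by simp, 0, rfl⟩
  | cons w ws ih =>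
    obtain rfl : w = [] := hws w (by simp)
    cases ws with
    | nil => exact ⟨[], rfl, by simp, 0, rfl⟩
    | cons w' ws =>
      obtain ⟨us, hlen, hus, n, hn⟩ := ih (fun v hv => hws v (by simp [hv])) (i + τ)
      refine ⟨blockAt x i τ :: us, by simpa using hlen, ?_, τ + n, ?_⟩
      · simpa using ⟨blockAt_mem_langN hx i τ, hus⟩
      · rw [blockAt_add, ← hn]
        simp [alternate]

theorem exists_alternate_mem_of_length_two_pow {A : Type*} {X : Set (ℤ → A)}
    {G : Set (List A)} {τ : ℕ}
    (hspec : ∀ n : ℕ, 1 ≤ n → ∀ v w : List A, v ∈ G → w ∈ G →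
      v.length = n → w.length = n → ∃ u ∈ langN X τ, v ++ u ++ w ∈ G)
    {n : ℕ} (hn : 1 ≤ n) (m : ℕ) (ws : List (List A)) (hlen : ws.length = 2 ^ m)
    (hws : ∀ w ∈ ws, w ∈ G ∧ w.length = n) :
    ∃ us : List (List A), ws.length = us.length + 1 ∧ (∀ u ∈ us, u ∈ langN X τ) ∧
      alternate ws us ∈ G := by
  induction m generalizing ws with
  | zero =>
    obtain ⟨w, rfl⟩ := List.length_eq_one_iff.mp (by simpa using hlen)
    exact ⟨[], rfl, by simp, by simpa [alternate] using (hws w (by simp)).1⟩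
  | succ m ih =>
    have hpow : 2 ^ (m + 1) = 2 ^ m + 2 ^ m := by ring
    have htake : ∀ w ∈ ws.take (2 ^ m), w ∈ G ∧ w.length = n :=
      fun w hw => hws w (List.mem_of_mem_take hw)
    have hdrop : ∀ w ∈ ws.drop (2 ^ m), w ∈ G ∧ w.length = n :=
      fun w hw => hws w (List.mem_of_mem_drop hw)
    obtain ⟨us₁, hl₁, hu₁, hG₁⟩ := ih (ws.take (2 ^ m)) (by simp; omega) htake
    obtain ⟨us₂, hl₂, hu₂, hG₂⟩ := ih (ws.drop (2 ^ m)) (by simp; omega) hdrop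
    have hcard : us₁.length = us₂.length := by
      simp only [List.length_take, List.length_drop] at hl₁ hl₂
      omega
    have hL₁ := length_alternate _ us₁ n τ hl₁ (fun w hw => (htake w hw).2)
      (fun u hu => (hu₁ u hu).2)
    have hL₂ := length_alternate _ us₂ n τ hl₂ (fun w hw => (hdrop w hw).2)
      (fun u hu => (hu₂ u hu).2)
    obtain ⟨u, hu, hG⟩ := hspec _ (by omega) _ _ hG₁ hG₂ hL₁ (by rw [hL₂, hcard])
    refine ⟨us₁ ++ u :: us₂, ?_, ?_, ?_⟩
    · simp only [List.length_take, List.length_drop, List.length_append,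
        List.length_cons] at hl₁ hl₂ ⊢
      omega
    · intro v hv
      rcases List.mem_append.mp hv with hv | hv
      · exact hu₁ v hv
      · rcases List.mem_cons.mp hv with rfl | hv
        · exact hu
        · exact hu₂ v hv
    · rwa [← alternate_append _ _ _ _ _ hl₁, List.take_append_drop] at hG

/-- One-step same-length specification implies multi-step specification,
with the same gap length `τ`. -/
theorem same_length_spec_iterate {A : Type*} [Fintype A]
    [TopologicalSpace A] [DiscreteTopology A]
    (X : Set (ℤ → A)) (hX : IsShiftSpace X)
    (G : Set (List A)) (hG : G ⊆ language X) (τ : ℕ)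
    (hspec : ∀ n : ℕ, 1 ≤ n → ∀ v w : List A, v ∈ G → w ∈ G →
      v.length = n → w.length = n → ∃ u ∈ langN X τ, v ++ u ++ w ∈ G) :
    ∀ k n : ℕ, 1 ≤ k → ∀ ws : List (List A), ws.length = k →
      (∀ w ∈ ws, w ∈ G ∧ w.length = n) →
      ∃ us : List (List A), us.length = k - 1 ∧ (∀ u ∈ us, u ∈ langN X τ) ∧
        alternate ws us ∈ language X := by
  rintro _ n hk ws rfl hws
  have hne : ws ≠ [] := List.length_pos_iff.mp hk
  have hhead := hws _ (List.head_mem hne)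
  rcases Nat.eq_zero_or_pos n with rfl | hn
  · obtain ⟨x, hx, -⟩ := hG hhead.1
    obtain ⟨us, hlen, hus, m, hm⟩ := exists_alternate_nil_eq_blockAt hx τ ws
      (fun w hw => List.length_eq_zero_iff.mp (hws w hw).2) 0
    exact ⟨us, hlen, hus, hm ▸ (blockAt_mem_langN hx 0 m).1⟩
  · have hpow : ws.length < 2 ^ ws.length := Nat.lt_two_pow_self
    set pad := List.replicate (2 ^ ws.length - ws.length) (ws.head hne) with hpad
    obtain ⟨us, hlen, hus, hmem⟩ := exists_alternate_mem_of_length_two_pow hspec hn ws.length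
      (ws ++ pad) (by simp [hpad]; omega) (by
        intro w hw
        rcases List.mem_append.mp hw with hw | hw
        · exact hws w hw
        · rwa [List.eq_of_mem_replicate hw])
    have htake : (us.take (ws.length - 1)).length = ws.length - 1 := by
      rw [List.length_append] at hlen
      rw [List.length_take]
      omega
    refine ⟨us.take (ws.length - 1), htake, fun u hu => hus u (List.mem_of_mem_take hu), ?_⟩
    have hprefix := alternate_prefix_append ws pad (us.take (ws.length - 1))
      (us.drop (ws.length - 1)) (by omega)
    rw [List.take_append_drop] at hprefix
    exact mem_language_of_prefix hprefix (hG hmem)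
end

section
/- Let A be a finite alphabet. For every n ∈ ℕ and every word v ∈ Aⁿ, there exists a symbol a ∈ A such that for every nonempty word u over A whose first symbol is not a, one has pre_ℓ(vu) = pre_ℓ(v) for all ℓ ∈ {1, …, ⌈n/2⌉}. -/
open MeasureTheory Filter Real Set

/-- Two periods `p`, `q` of a word with `p + q` at most its length predict the same next symbol. -/
theorem getElem?_length_mod_eq {A : Type*} {v : List A} {p q : ℕ} (hp : 1 ≤ p) (hq : 1 ≤ q)
    (hpq : p + q ≤ v.length)
    (hvp : ∀ t < v.length, v[t]? = v[t % p]?) (hvq : ∀ t < v.length, v[t]? = v[t % q]?) :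
    v[v.length % p]? = v[v.length % q]? := by
  have key : ∀ r s : ℕ, 1 ≤ r → 1 ≤ s → r + s ≤ v.length →
      (∀ t < v.length, v[t]? = v[t % r]?) → (∀ t < v.length, v[t]? = v[t % s]?) →
      v[v.length % r]? = v[v.length - (r + s)]? := by
    intro r s hr hs hrs hvr hvs
    rw [Nat.mod_eq_sub_mod (by omega : r ≤ v.length), ← hvr _ (by omega), hvs _ (by omega),
      Nat.mod_eq_sub_mod (by omega : s ≤ v.length - r), ← hvs _ (by omega), Nat.sub_sub]
  rw [key p q hp hq hpq hvp hvq, key q p hq hp (by omega) hvq hvp, Nat.add_comm]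

/-- Appending `u` does not change `preK` when `u` does not start with the symbol that would
continue the period `ℓ` of `v`. -/
theorem preK_append_eq {A : Type*} {v u : List A} {ℓ : ℕ} (hℓ : 1 ≤ ℓ) (hℓv : ℓ ≤ v.length)
    (h : (∀ t < v.length, v[t]? = v[t % ℓ]?) → u.head? ≠ v[v.length % ℓ]?) :
    preK (v ++ u) ℓ = preK v ℓ := by
  have hmod : ∀ t, t % ℓ < v.length := fun t => (Nat.mod_lt t hℓ).trans_le hℓv
  unfold preK
  congr 1
  ext k
  simp only [Set.mem_ofPred_eq, List.length_append]
  constructor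
  · rintro ⟨-, hk⟩
    have hkv : k ≤ v.length := by
      by_contra! hlt
      refine h (fun t ht => ?_) ?_
      · simpa [List.getElem?_append_left, ht, hmod t] using hk t (ht.trans hlt)
      · have := hk v.length hlt
        rw [List.getElem?_append_left (hmod _), List.getElem?_append_right le_rfl,
          Nat.sub_self] at this
        rw [List.head?_eq_getElem?, this]
    refine ⟨hkv, fun t ht => ?_⟩
    have := hk t ht
    rwa [List.getElem?_append_left (hmod _), List.getElem?_append_left (by omega)] at this
  · rintro ⟨hkv, hk⟩
    refine ⟨by omega, fun t ht => ?_⟩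
    rw [List.getElem?_append_left (hmod _), List.getElem?_append_left (by omega)]
    exact hk t ht

/-- For any word `v` there is a symbol `a` such that appending any nonempty word
not starting with `a` does not change `pre_ℓ` for `ℓ ≤ ⌈|v|/2⌉`. -/
theorem pre_stable_of_append {A : Type*} [Fintype A] [Nonempty A] :
    ∀ n : ℕ, ∀ v : List A, v.length = n →
      ∃ a : A, ∀ u : List A, u ≠ [] → u.head? ≠ some a →
        ∀ ℓ : ℕ, 1 ≤ ℓ → ℓ ≤ (n + 1) / 2 → pre (v ++ u) ℓ = pre v ℓ := by
  rintro n v rfl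
  obtain ⟨a, ha⟩ : ∃ a : A, ∀ ℓ : ℕ, 1 ≤ ℓ → ℓ ≤ (v.length + 1) / 2 →
      (∀ t < v.length, v[t]? = v[t % ℓ]?) → v[v.length % ℓ]? = some a := by
    by_cases hex : ∃ p : ℕ, 1 ≤ p ∧ p ≤ (v.length + 1) / 2 ∧ ∀ t < v.length, v[t]? = v[t % p]?
    · obtain ⟨p, hp, hpv, hvp⟩ := hex
      have hlt : v.length % p < v.length := (Nat.mod_lt _ hp).trans_le (by omega)
      refine ⟨v[v.length % p], fun ℓ hℓ hℓv hvℓ => ?_⟩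
      rw [← List.getElem?_eq_getElem hlt]
      rcases eq_or_ne ℓ p with rfl | hne
      · rfl
      · exact getElem?_length_mod_eq hℓ hp (by omega) hvℓ hvp
    · exact ⟨Classical.arbitrary A, fun ℓ hℓ hℓv hvℓ => (hex ⟨ℓ, hℓ, hℓv, hvℓ⟩).elim⟩
  refine ⟨a, fun u _ hua ℓ hℓ hℓv => ?_⟩
  rw [pre, pre, preK_append_eq hℓ (by omega) fun hv => by rwa [ha ℓ hℓ hℓv hv]]
end

section
/- Let A be a finite alphabet. For every pair of words v, w over A, there exist symbols a₁, a₂ ∈ A such that for every τ ≥ 1 and every word u ∈ A^τ whose first symbol differs from a₁ and whose last symbol differs from a₂: pre_ℓ(vuw) = pre_ℓ(v) for every ℓ ∈ {1, …, ⌈|v|/2⌉}, and suf_ℓ(vuw) = suf_ℓ(w) for every ℓ ∈ {1, …, ⌈|w|/2⌉}. -/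
open MeasureTheory Filter Real Set

/-- Two full periods of `v` of length at most half of `v`, rounded up, predict the same next
symbol. -/
lemma getElem?_mod_eq_of_periods {A : Type*} {v : List A} {p q : ℕ}
    (hp : 1 ≤ p) (hpn : p ≤ (v.length + 1) / 2) (hq : 1 ≤ q) (hqn : q ≤ (v.length + 1) / 2)
    (Hp : ∀ t < v.length, v[t]? = v[t % p]?) (Hq : ∀ t < v.length, v[t]? = v[t % q]?) :
    v[v.length % p]? = v[v.length % q]? := by
  by_cases h : p + q ≤ v.length
  · have e₁ := Hp (v.length - p) (by omega)
    have e₂ := Hq (v.length - q) (by omega)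
    have e₃ := Hp (v.length - q) (by omega)
    have e₄ := Hp (v.length - q - p) (by omega)
    have e₅ := Hq (v.length - p) (by omega)
    have e₆ := Hq (v.length - p - q) (by omega)
    rw [← Nat.mod_eq_sub_mod (by omega)] at e₁ e₂ e₄ e₆
    rw [Nat.sub_right_comm] at e₄
    rw [← e₁, e₅, ← e₆, e₄, ← e₃, e₂]
  · obtain rfl : p = q := by omega
    rfl

/-- Extending `v` by a word whose first symbol avoids a suitable letter does not change the
initial periodic runs of `v` with short periods. -/
lemma exists_forall_preK_append_eq {A : Type*} [Nonempty A] (v : List A) :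
    ∃ a : A, ∀ x : List A, x ≠ [] → x.head? ≠ some a →
      ∀ ℓ : ℕ, 1 ≤ ℓ → ℓ ≤ (v.length + 1) / 2 → preK (v ++ x) ℓ = preK v ℓ := by
  obtain ⟨a, ha⟩ : ∃ a : A, ∀ ℓ : ℕ, 1 ≤ ℓ → ℓ ≤ (v.length + 1) / 2 →
      (∀ t < v.length, v[t]? = v[t % ℓ]?) → v[v.length % ℓ]? = some a := by
    by_cases h : ∃ p : ℕ, 1 ≤ p ∧ p ≤ (v.length + 1) / 2 ∧ ∀ t < v.length, v[t]? = v[t % p]?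
    · obtain ⟨p, hp, hpn, Hp⟩ := h
      have hlt : v.length % p < v.length := (Nat.mod_lt _ hp).trans_le (by omega)
      refine ⟨v[v.length % p], fun ℓ hℓ hℓn Hℓ => ?_⟩
      rw [getElem?_mod_eq_of_periods hℓ hℓn hp hpn Hℓ Hp, List.getElem?_eq_getElem hlt]
    · exact ⟨Classical.arbitrary A, fun ℓ hℓ hℓn Hℓ => absurd ⟨ℓ, hℓ, hℓn, Hℓ⟩ h⟩
  refine ⟨a, fun x hx hxa ℓ hℓ hℓn => ?_⟩
  have restrict : ∀ t < v.length, ((v ++ x)[t]? = (v ++ x)[t % ℓ]? ↔ v[t]? = v[t % ℓ]?) := by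
    intro t ht
    rw [List.getElem?_append_left ht,
      List.getElem?_append_left ((Nat.mod_le t ℓ).trans_lt ht)]
  unfold preK
  congr 1
  ext k
  constructor
  · rintro ⟨-, H⟩
    have hk : k ≤ v.length := by
      by_contra! hk
      have hnext := H v.length hk
      rw [List.getElem?_append_right le_rfl,
        List.getElem?_append_left ((Nat.mod_lt _ hℓ).trans_le (by omega)),
        ha ℓ hℓ hℓn fun t ht => (restrict t ht).1 (H t (ht.trans hk)),
        Nat.sub_self, ← List.head?_eq_getElem?] at hnext
      exact hxa hnext
    exact ⟨hk, fun t ht => (restrict t (ht.trans_le hk)).1 (H t ht)⟩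
  · rintro ⟨hk, H⟩
    refine ⟨?_, fun t ht => (restrict t (ht.trans_le hk)).2 (H t ht)⟩
    rw [List.length_append]
    omega

/-- For any words `v, w` there are symbols `a₁, a₂` such that inserting any word `u`
whose first symbol is not `a₁` and whose last symbol is not `a₂` preserves the
prefix-repetition counts of `v` and the suffix-repetition counts of `w`. -/
theorem pre_suf_stable_of_glue {A : Type*} [Fintype A] [Nonempty A] :
    ∀ v w : List A, ∃ a₁ a₂ : A,
      ∀ τ : ℕ, 1 ≤ τ → ∀ u : List A, u.length = τ →
        u.head? ≠ some a₁ → u.getLast? ≠ some a₂ →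
        (∀ ℓ : ℕ, 1 ≤ ℓ → ℓ ≤ (v.length + 1) / 2 →
          pre (v ++ u ++ w) ℓ = pre v ℓ) ∧
        (∀ ℓ : ℕ, 1 ≤ ℓ → ℓ ≤ (w.length + 1) / 2 →
          suf (v ++ u ++ w) ℓ = suf w ℓ) := by
  intro v w
  obtain ⟨a₁, h₁⟩ := exists_forall_preK_append_eq v
  obtain ⟨a₂, h₂⟩ := exists_forall_preK_append_eq w.reverse
  refine ⟨a₁, a₂, fun τ hτ u hu hhead hlast => ?_⟩
  have hne : u ≠ [] := List.ne_nil_of_length_pos (by omega)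
  refine ⟨fun ℓ hℓ hℓn => ?_, fun ℓ hℓ hℓn => ?_⟩
  · rw [pre, pre, List.append_assoc, h₁ (u ++ w) (by simp [hne]) _ ℓ hℓ hℓn]
    rwa [List.head?_append_of_ne_nil _ hne]
  · rw [suf, suf, pre, pre, List.reverse_append, List.reverse_append,
      h₂ (u.reverse ++ v.reverse) (by simp [hne]) _ ℓ hℓ (by simpa using hℓn)]
    rwa [List.head?_append_of_ne_nil _ (by simpa using hne), List.head?_reverse]
end

section
/- Let X be a shift space on a finite alphabet with language L and topological entropy h. Suppose C^p, G, C^s ⊆ L satisfy: (I) every w ∈ L can be written w = u^p v u^s with u^p ∈ C^p, v ∈ G, u^s ∈ C^s; and (II') Q := (Σ_{i≥0} #C^p_i e^{−ih})(Σ_{k≥0} #C^s_k e^{−kh}) < ∞. If there is a constant C₁ > 0 with #G_n ≤ C₁ e^{nh} for all n, then #L_n ≤ C₁ Q e^{nh} for all n ∈ ℕ. -/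
open MeasureTheory Filter Real Set

/-- The words of length `n` that split as `u ++ v ++ w` with `u ∈ S` of length `i`, `v ∈ G`, and
`w ∈ T` of length `k`. -/
def splitWords {A : Type*} (S G T : Set (List A)) (n i k : ℕ) : Set (List A) :=
  {x | x.length = n ∧ ∃ u ∈ S, u.length = i ∧ ∃ v ∈ G, ∃ w ∈ T, w.length = k ∧ x = u ++ v ++ w}

theorem ncard_splitWords_le {A : Type*} [Finite A] (S G T : Set (List A)) (n i k : ℕ) :
    (splitWords S G T n i k).ncard ≤ {w ∈ S | w.length = i}.ncard *
      ({w ∈ G | w.length = n - i - k}.ncard * {w ∈ T | w.length = k}.ncard) := by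
  have hfin (U : Set (List A)) (m : ℕ) : {w ∈ U | w.length = m}.Finite :=
    (List.finite_length_eq A m).subset fun _ hw => hw.2
  rw [← Set.ncard_prod, ← Set.ncard_prod]
  refine (Set.ncard_le_ncard (t := (fun p : List A × List A × List A => p.1 ++ p.2.1 ++ p.2.2) ''
    ({w ∈ S | w.length = i} ×ˢ {w ∈ G | w.length = n - i - k} ×ˢ {w ∈ T | w.length = k})) ?_
    (((hfin S i).prod ((hfin G _).prod (hfin T k))).image _)).trans
    (Set.ncard_image_le ((hfin S i).prod ((hfin G _).prod (hfin T k))))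
  rintro x ⟨hx, u, hu, hui, v, hv, w, hw, hwk, rfl⟩
  simp only [List.length_append] at hx
  have hvl : v.length = n - i - k := by omega
  exact ⟨(u, v, w), ⟨⟨hu, hui⟩, ⟨hv, hvl⟩, ⟨hw, hwk⟩⟩, rfl⟩

theorem ncard_splitWords_le_mul_exp {A : Type*} [Finite A] (S G T : Set (List A)) (h C : ℝ)
    (hC : 0 < C)
    (hG : ∀ n : ℕ, (({w ∈ G | w.length = n}).ncard : ℝ) ≤ C * Real.exp (n * h)) (n i k : ℕ) :
    ((splitWords S G T n i k).ncard : ℝ) ≤ C * Real.exp (n * h) *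
      ((({w ∈ S | w.length = i}).ncard * Real.exp (-(i : ℝ) * h)) *
        (({w ∈ T | w.length = k}).ncard * Real.exp (-(k : ℝ) * h))) := by
  by_cases hik : i + k ≤ n
  · calc ((splitWords S G T n i k).ncard : ℝ)
        ≤ {w ∈ S | w.length = i}.ncard *
            ({w ∈ G | w.length = n - i - k}.ncard * {w ∈ T | w.length = k}.ncard) :=
          mod_cast ncard_splitWords_le S G T n i k
      _ ≤ {w ∈ S | w.length = i}.ncard *
            ((C * Real.exp ((n - i - k : ℕ) * h)) * {w ∈ T | w.length = k}.ncard) := by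
          gcongr
          exact hG _
      _ = _ := by
          have hexp : Real.exp ((n - i - k : ℕ) * h) =
              Real.exp (n * h) * Real.exp (-(i : ℝ) * h) * Real.exp (-(k : ℝ) * h) := by
            rw [Nat.sub_sub, Nat.cast_sub hik, ← Real.exp_add, ← Real.exp_add]
            congr 1
            push_cast
            ring
          rw [hexp]
          ring
  · have hempty : splitWords S G T n i k = ∅ := by
      refine Set.eq_empty_of_forall_notMem ?_
      rintro x ⟨hx, u, -, hui, v, -, w, -, hwk, rfl⟩
      simp only [List.length_append] at hx
      omega
    rw [hempty, Set.ncard_empty, Nat.cast_zero]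
    positivity

/-- From the decomposition (I), finiteness of `Q` (II'), and a uniform bound on
good words, one gets `#L_n ≤ C₁ Q e^{nh}`. -/
theorem lang_le_of_decomposition {A : Type*} [Fintype A]
    [TopologicalSpace A] [DiscreteTopology A]
    (X : Set (ℤ → A)) (hX : IsShiftSpace X) (h : ℝ)
    (hEnt : Tendsto (fun n : ℕ => Real.log ((langN X n).ncard) / n) atTop (nhds h))
    (Cp G Cs : Set (List A))
    (hCp : Cp ⊆ language X) (hG : G ⊆ language X) (hCs : Cs ⊆ language X)
    (hI : ∀ w ∈ language X, ∃ up ∈ Cp, ∃ v ∈ G, ∃ us ∈ Cs, w = up ++ v ++ us)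
    (hSump : Summable fun i : ℕ =>
      (({w ∈ Cp | w.length = i}).ncard : ℝ) * Real.exp (-(i : ℝ) * h))
    (hSums : Summable fun k : ℕ =>
      (({w ∈ Cs | w.length = k}).ncard : ℝ) * Real.exp (-(k : ℝ) * h))
    (C₁ : ℝ) (hC₁ : 0 < C₁)
    (hGle : ∀ n : ℕ, (({w ∈ G | w.length = n}).ncard : ℝ) ≤ C₁ * Real.exp (n * h)) :
    ∀ n : ℕ, ((langN X n).ncard : ℝ) ≤
      C₁ * ((∑' i : ℕ, (({w ∈ Cp | w.length = i}).ncard : ℝ) * Real.exp (-(i : ℝ) * h)) *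
        (∑' k : ℕ, (({w ∈ Cs | w.length = k}).ncard : ℝ) * Real.exp (-(k : ℝ) * h))) *
      Real.exp (n * h) := by
  intro n
  set p : ℕ → ℝ := fun i => ({w ∈ Cp | w.length = i}).ncard * Real.exp (-(i : ℝ) * h)
  set s : ℕ → ℝ := fun k => ({w ∈ Cs | w.length = k}).ncard * Real.exp (-(k : ℝ) * h)
  have hp (i : ℕ) : 0 ≤ p i := by positivity
  have hs (k : ℕ) : 0 ≤ s k := by positivity
  set I := Finset.range (n + 1) ×ˢ Finset.range (n + 1)
  have hcover : langN X n ⊆ ⋃ x ∈ I, splitWords Cp G Cs n x.1 x.2 := by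
    rintro w ⟨hw, hlen⟩
    obtain ⟨u, hu, v, hv, t, ht, rfl⟩ := hI w hw
    have hlen' := hlen
    simp only [List.length_append] at hlen'
    simp only [Set.mem_iUnion]
    refine ⟨(u.length, t.length), ?_, hlen, u, hu, rfl, v, hv, t, ht, rfl, rfl⟩
    simp only [I, Finset.mem_product, Finset.mem_range]
    omega
  have hfin : (⋃ x ∈ I, splitWords Cp G Cs n x.1 x.2).Finite :=
    (List.finite_length_eq A n).subset (Set.iUnion₂_subset fun _ _ _ hw => hw.1)
  calc ((langN X n).ncard : ℝ)
      ≤ ∑ x ∈ I, ((splitWords Cp G Cs n x.1 x.2).ncard : ℝ) :=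
        mod_cast (Set.ncard_le_ncard hcover hfin).trans (Finset.set_ncard_biUnion_le I _)
    _ ≤ ∑ x ∈ I, C₁ * Real.exp (n * h) * (p x.1 * s x.2) :=
        Finset.sum_le_sum fun x _ =>
          ncard_splitWords_le_mul_exp Cp G Cs h C₁ hC₁ hGle n x.1 x.2
    _ = C₁ * Real.exp (n * h) *
          ((∑ i ∈ Finset.range (n + 1), p i) * ∑ k ∈ Finset.range (n + 1), s k) := by
        rw [← Finset.mul_sum, Finset.sum_mul_sum, Finset.sum_product]
    _ ≤ C₁ * Real.exp (n * h) * ((∑' i, p i) * ∑' k, s k) := by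
        gcongr
        · exact hSump.sum_le_tsum _ fun i _ => hp i
        · exact hSums.sum_le_tsum _ fun k _ => hs k
    _ = C₁ * ((∑' i, p i) * ∑' k, s k) * Real.exp (n * h) := by ring
end
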